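/- Let (x_i[n])_{i=1}^I, n ≥ 0, be the sequences generated by the inexact NEXT algorithm, and let x̄[n] := (1/I) Σ_{i=1}^I x_i[n]. Suppose Assumptions A, F, B hold, the step sizes satisfy α[n] ∈ (0, 1] for all n, Σ_n α[n] = ∞ and Σ_n α[n]² < ∞, the error sequences (ε_i[n])_n are nonnegative, uniformly bounded, and satisfy Σ_n α[n] ε_i[n] < ∞ for every i. Then: (a) the sequence (x̄[n])_n is bounded and every limit point of (x̄[n])_n is a stationary solution of min_{x∈K} F(x) + G(x); and (b) for every i = 1,…,I, ‖x_i[n] − x̄[n]‖ → 0 as n → ∞. -/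

import Mathlib

open Filter
open scoped InnerProductSpace

theorem ConvexOn.exists_subgradient_of_forall_le {E : Type*} [NormedAddCommGroup E]
    [InnerProductSpace ℝ E] [FiniteDimensional ℝ E] {K : Set E} (hK : Convex ℝ K) {G : E → ℝ}
    (hG : ConvexOn ℝ Set.univ G) {p : E} (hp : p ∈ K) (c : E)
    (h : ∀ v ∈ K, G p ≤ ⟪c, v - p⟫_ℝ + G v) :
    ∃ g : E, (∀ y, G p + ⟪g, y - p⟫_ℝ ≤ G y) ∧ ∀ y ∈ K, 0 ≤ ⟪c + g, y - p⟫_ℝ := by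
  have hGc : Continuous G := continuousOn_univ.mp (hG.continuousOn isOpen_univ)
  have hA : Convex ℝ {q : E × ℝ | q.1 ∈ Set.univ ∧ G q.1 < q.2} := hG.convex_strict_epigraph
  have hAo : IsOpen {q : E × ℝ | q.1 ∈ Set.univ ∧ G q.1 < q.2} := by
    simpa using isOpen_lt (hGc.comp continuous_fst) continuous_snd
  have hB : Convex ℝ {q : E × ℝ | q.1 ∈ K ∧ q.2 ≤ G p - ⟪c, q.1 - p⟫_ℝ} := by
    rintro ⟨v, s⟩ ⟨hv, hs⟩ ⟨w, t⟩ ⟨hw, ht⟩ a b ha hb hab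
    refine ⟨hK hv hw ha hb hab, ?_⟩
    simp only [Prod.fst_add, Prod.smul_fst, Prod.snd_add, Prod.smul_snd, smul_eq_mul,
      inner_sub_right, inner_add_right, inner_smul_right] at *
    have hb' : b = 1 - a := by linarith
    subst hb'
    nlinarith [mul_le_mul_of_nonneg_left hs ha, mul_le_mul_of_nonneg_left ht hb]
  have hAB : Disjoint {q : E × ℝ | q.1 ∈ Set.univ ∧ G q.1 < q.2}
      {q : E × ℝ | q.1 ∈ K ∧ q.2 ≤ G p - ⟪c, q.1 - p⟫_ℝ} := by
    rw [Set.disjoint_left]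
    rintro ⟨v, t⟩ ⟨-, h1⟩ ⟨hv, h2⟩
    have := h v hv
    simp only at h1 h2 hv
    linarith
  obtain ⟨F, u, hFA, hFB⟩ := geometric_hahn_banach_open hA hAo hB hAB
  obtain ⟨l, hl⟩ : ∃ l : E, ∀ v, F (v, 0) = ⟪l, v⟫_ℝ :=
    ⟨(InnerProductSpace.toDual ℝ E).symm (F.comp (ContinuousLinearMap.inl ℝ E ℝ)), fun v => by simp⟩
  have hF : ∀ v t, F (v, t) = ⟪l, v⟫_ℝ + t * F (0, 1) := fun v t => by
    rw [← hl, ← smul_eq_mul, ← map_smul, ← map_add]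
    simp
  set s := F (0, 1)
  have h1 := hFA (p, G p + 1) ⟨Set.mem_univ _, by simp⟩
  have h2 := hFB (p, G p) ⟨hp, by simp⟩
  rw [hF] at h1 h2
  have hs : s < 0 := by linarith
  have h3 : ∀ v, ⟪l, v⟫_ℝ + G v * s ≤ u := fun v => by
    refine le_of_forall_pos_le_add fun e he => ?_
    have := hFA (v, G v + e / (-s)) ⟨Set.mem_univ _, by simpa using div_pos he (neg_pos.2 hs)⟩
    rw [hF, add_mul, div_mul_eq_mul_div, mul_div_assoc, div_neg, div_self hs.ne] at this
    linarith
  refine ⟨(-s)⁻¹ • l, fun y => ?_, fun y hy => ?_⟩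
  · have h4 := h3 y
    rw [inner_smul_left, inner_sub_right]
    simp only [conj_trivial]
    rw [← le_sub_iff_add_le', inv_mul_le_iff₀ (neg_pos.2 hs)]
    linarith
  · have h4 := hFB (y, G p - ⟪c, y - p⟫_ℝ) ⟨hy, by simp⟩
    have h5 := h3 p
    rw [hF] at h4
    rw [inner_add_left, inner_smul_left]
    simp only [conj_trivial]
    have h6 : (-s) * (⟪c, y - p⟫_ℝ + (-s)⁻¹ * ⟪l, y - p⟫_ℝ)
        = (-s) * ⟪c, y - p⟫_ℝ + ⟪l, y - p⟫_ℝ := by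
      field_simp [hs.ne]
      ring
    have h7 : 0 ≤ (-s) * (⟪c, y - p⟫_ℝ + (-s)⁻¹ * ⟪l, y - p⟫_ℝ) := by
      rw [h6, inner_sub_right l]
      linarith
    exact nonneg_of_mul_nonneg_right h7 (neg_pos.2 hs)

theorem ConvexOn.abs_sub_le_of_subgradient_norm_le {E : Type*} [NormedAddCommGroup E]
    [InnerProductSpace ℝ E] [FiniteDimensional ℝ E] {K : Set E} {G : E → ℝ}
    (hG : ConvexOn ℝ Set.univ G) {C : ℝ}
    (hC : ∀ x ∈ K, ∀ g, (∀ y, G x + ⟪g, y - x⟫_ℝ ≤ G y) → ‖g‖ ≤ C) {x y : E}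
    (hx : x ∈ K) (hy : y ∈ K) : |G x - G y| ≤ C * ‖x - y‖ := by
  have key : ∀ a ∈ K, ∀ b, G a - G b ≤ C * ‖a - b‖ := fun a ha b => by
    obtain ⟨g, hg, -⟩ := hG.exists_subgradient_of_forall_le (convex_singleton a)
      (Set.mem_singleton a) 0 (by simp)
    have h1 := hg b
    have h2 : ⟪g, a - b⟫_ℝ ≤ C * ‖a - b‖ :=
      (real_inner_le_norm _ _).trans (by gcongr; exact hC a ha g hg)
    rw [← neg_sub b a, inner_neg_right] at h2
    rw [← neg_sub b a]
    linarith
  rw [abs_le]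
  have h1 := key y hy x
  rw [norm_sub_rev] at h1
  exact ⟨by linarith, key x hx y⟩

theorem HasDerivAt.le_of_forall_le_add_mul {φ : ℝ → ℝ} {d A C : ℝ} (h : HasDerivAt φ d 0)
    (hle : ∀ t ∈ Set.Ioo (0 : ℝ) 1, φ t ≤ φ 0 + t * (A + t * C)) : d ≤ A := by
  have h1 := h.tendsto_slope_zero_right
  have h2 : Tendsto (fun t : ℝ => A + t * C) (nhdsWithin 0 (Set.Ioi 0)) (nhds A) := by
    have : Continuous fun t : ℝ => A + t * C := by fun_prop
    simpa using (this.tendsto 0).mono_left nhdsWithin_le_nhds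
  refine le_of_tendsto_of_tendsto h1 h2 ?_
  filter_upwards [Ioo_mem_nhdsGT (zero_lt_one' ℝ)] with t ht
  have := hle t ht
  rw [zero_add, smul_eq_mul, inv_mul_le_iff₀ ht.1]
  linarith

theorem HasGradientAt.hasDerivAt_add_smul {E : Type*} [NormedAddCommGroup E]
    [InnerProductSpace ℝ E] [CompleteSpace E] {f : E → ℝ} {g x : E} (h : HasGradientAt f g x)
    (v : E) : HasDerivAt (fun t : ℝ => f (x + t • v)) ⟪g, v⟫_ℝ 0 := by
  have h1 : HasDerivAt (fun t : ℝ => x + t • v) v 0 := by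
    simpa using ((hasDerivAt_id (0 : ℝ)).smul_const v).const_add x
  have h2 : HasFDerivAt f (InnerProductSpace.toDual ℝ E g) (x + (0 : ℝ) • v) := by
    simpa using h.hasFDerivAt
  exact h2.comp_hasDerivAt 0 h1

theorem StrongConvexOn.add_inner_add_le {E : Type*} [NormedAddCommGroup E]
    [InnerProductSpace ℝ E] [CompleteSpace E] {K : Set E} {f : E → ℝ} {g x u : E} {m : ℝ}
    (hf : StrongConvexOn K m f) (hx : x ∈ K) (hu : u ∈ K) (h : HasGradientAt f g x) :
    f x + ⟪g, u - x⟫_ℝ + m / 2 * ‖x - u‖ ^ 2 ≤ f u := by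
  have := (h.hasDerivAt_add_smul (u - x)).le_of_forall_le_add_mul
    (A := f u - f x - m / 2 * ‖x - u‖ ^ 2) (C := m / 2 * ‖x - u‖ ^ 2) fun t ht => by
      have h1 := hf.2 hx hu (sub_nonneg.2 ht.2.le) ht.1.le (sub_add_cancel 1 t)
      have h2 : (1 - t) • x + t • u = x + t • (u - x) := by module
      rw [h2] at h1
      simp only [smul_eq_mul, zero_smul, add_zero] at h1 ⊢
      linarith
  linarith

theorem StrongConvexOn.add_sq_le_of_isMinOn {E : Type*} [NormedAddCommGroup E]
    [NormedSpace ℝ E] {K : Set E} {f : E → ℝ} {x u : E} {m : ℝ}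
    (hf : StrongConvexOn K m f) (hx : x ∈ K) (hu : u ∈ K) (h : ∀ v ∈ K, f x ≤ f v) :
    f x + m / 2 * ‖x - u‖ ^ 2 ≤ f u := by
  have := (hasDerivAt_const (0 : ℝ) (0 : ℝ)).le_of_forall_le_add_mul
    (A := f u - f x - m / 2 * ‖x - u‖ ^ 2) (C := m / 2 * ‖x - u‖ ^ 2) fun t ht => by
      have h1 := hf.2 hx hu (sub_nonneg.2 ht.2.le) ht.1.le (sub_add_cancel 1 t)
      have h2 := h _ (hf.1 hx hu (sub_nonneg.2 ht.2.le) ht.1.le (sub_add_cancel 1 t))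
      simp only [smul_eq_mul] at h1 ⊢
      linarith
  linarith

theorem Convex.abs_sub_sub_inner_le {E : Type*} [NormedAddCommGroup E]
    [InnerProductSpace ℝ E] [CompleteSpace E] {K : Set E} (hK : Convex ℝ K) {f : E → ℝ}
    {gf : E → E} {C : ℝ} {x y g : E} (hf : ∀ z ∈ K, HasGradientAt f (gf z) z)
    (hC : ∀ z ∈ K, ‖gf z - g‖ ≤ C) (hx : x ∈ K) (hy : y ∈ K) :
    |f y - f x - ⟪g, y - x⟫_ℝ| ≤ C * ‖y - x‖ := by
  have := hK.norm_image_sub_le_of_norm_hasFDerivWithin_le' (φ := InnerProductSpace.toDual ℝ E g)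
    (f' := fun z => InnerProductSpace.toDual ℝ E (gf z))
    (fun z hz => (hf z hz).hasFDerivAt.hasFDerivWithinAt)
    (fun z hz => by rw [← map_sub, LinearIsometryEquiv.norm_map]; exact hC z hz) hx hy
  simpa using this

theorem abs_sub_sub_inner_le_of_lipschitz_gradient {E : Type*} [NormedAddCommGroup E]
    [InnerProductSpace ℝ E] [CompleteSpace E] {K : Set E} (hK : Convex ℝ K) {f : E → ℝ}
    {gf : E → E} {L : ℝ} {x y : E} (hf : ∀ z ∈ K, HasGradientAt f (gf z) z)
    (hL : ∀ z ∈ K, ∀ w ∈ K, ‖gf z - gf w‖ ≤ L * ‖z - w‖) (hx : x ∈ K) (hy : y ∈ K) :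
    |f y - f x - ⟪gf x, y - x⟫_ℝ| ≤ |L| * ‖y - x‖ ^ 2 := by
  have hs : segment ℝ x y ⊆ K := hK.segment_subset hx hy
  have := (convex_segment x y).abs_sub_sub_inner_le (C := |L| * ‖y - x‖) (g := gf x)
    (fun z hz => hf z (hs hz)) (fun z hz => (hL z (hs hz) x hx).trans ?_)
    (left_mem_segment ℝ x y) (right_mem_segment ℝ x y)
  · linarith
  · have h1 : ‖z - x‖ ≤ ‖y - x‖ := by
      obtain ⟨a, b, ha, hb, hab, rfl⟩ := hz
      have : a • x + b • y - x = b • (y - x) := by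
        obtain rfl : a = 1 - b := by linarith
        module
      rw [this, norm_smul, Real.norm_of_nonneg hb]
      exact mul_le_of_le_one_left (norm_nonneg _) (by linarith)
    gcongr
    exact le_abs_self L

theorem abs_sub_sub_sub_le_of_gradient_sub_le {E : Type*} [NormedAddCommGroup E]
    [InnerProductSpace ℝ E] [CompleteSpace E] {K : Set E} (hK : Convex ℝ K) {f₁ f₂ : E → ℝ}
    {g₁ g₂ : E → E} {C : ℝ} {u v : E} (h₁ : ∀ z ∈ K, HasGradientAt f₁ (g₁ z) z)
    (h₂ : ∀ z ∈ K, HasGradientAt f₂ (g₂ z) z) (hC : ∀ z ∈ K, ‖g₁ z - g₂ z‖ ≤ C)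
    (hu : u ∈ K) (hv : v ∈ K) : |(f₁ v - f₁ u) - (f₂ v - f₂ u)| ≤ C * ‖v - u‖ := by
  have := hK.norm_image_sub_le_of_norm_hasFDerivWithin_le (f := f₁ - f₂)
    (f' := fun z => InnerProductSpace.toDual ℝ E (g₁ z) - InnerProductSpace.toDual ℝ E (g₂ z))
    (fun z hz => ((h₁ z hz).hasFDerivAt.sub (h₂ z hz).hasFDerivAt).hasFDerivWithinAt)
    (fun z hz => by rw [← map_sub, LinearIsometryEquiv.norm_map]; exact hC z hz) hu hv
  rw [Real.norm_eq_abs] at this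
  convert this using 2
  simp only [Pi.sub_apply]
  ring

theorem summable_of_le_mul_add_of_shift {a b : ℕ → ℝ} {ρ : ℝ} {T : ℕ} (ha : ∀ n, 0 ≤ a n)
    (hb : ∀ n, 0 ≤ b n) (hbs : Summable b) (hρ : ρ < 1)
    (h : ∀ n, a (n + T) ≤ ρ * a n + b n) : Summable a := by
  refine summable_of_sum_range_le (c := (∑ n ∈ Finset.range T, a n + ∑' n, b n) / (1 - ρ)) ha
    fun N => ?_
  rw [le_div_iff₀ (by linarith)]
  have h1 : ∑ n ∈ Finset.range N, a n ≤ ∑ n ∈ Finset.range (T + N), a n :=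
    Finset.sum_le_sum_of_subset_of_nonneg (Finset.range_mono (by omega)) fun i _ _ => ha i
  rw [Finset.sum_range_add] at h1
  have h2 : ∑ n ∈ Finset.range N, a (T + n)
      ≤ ρ * ∑ n ∈ Finset.range N, a n + ∑ n ∈ Finset.range N, b n := by
    rw [Finset.mul_sum, ← Finset.sum_add_distrib]
    exact Finset.sum_le_sum fun n _ => by simpa [add_comm] using h n
  have h3 := hbs.sum_le_tsum (Finset.range N) fun i _ => hb i
  linarith

theorem summable_sq_of_le_mul_add_of_shift {a b : ℕ → ℝ} {ρ : ℝ} {T : ℕ} (ha : ∀ n, 0 ≤ a n)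
    (hbs : Summable fun n => b n ^ 2) (hρ0 : 0 ≤ ρ) (hρ : ρ < 1)
    (h : ∀ n, a (n + T) ≤ ρ * a n + b n) : Summable fun n => a n ^ 2 := by
  have hρ' : 0 < 1 - ρ := by linarith
  refine summable_of_le_mul_add_of_shift (b := fun n => b n ^ 2 / (1 - ρ)) (T := T)
    (fun n => sq_nonneg _) (fun n => by positivity) (hbs.div_const _) hρ fun n => ?_
  have h1 : a (n + T) ^ 2 ≤ (ρ * a n + b n) ^ 2 := pow_le_pow_left₀ (ha _) (h n) 2
  refine h1.trans ?_
  rw [← sub_nonneg]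
  have : ρ * a n ^ 2 + b n ^ 2 / (1 - ρ) - (ρ * a n + b n) ^ 2
      = ρ * ((1 - ρ) * a n - b n) ^ 2 / (1 - ρ) := by
    field_simp
    ring
  rw [this]
  positivity

theorem exists_forall_le_of_le_mul_add_of_shift {a : ℕ → ℝ} {ρ b : ℝ} {T : ℕ} (hT : 0 < T)
    (hρ0 : 0 ≤ ρ) (hρ : ρ < 1) (h : ∀ n, a (n + T) ≤ ρ * a n + b) : ∃ C, ∀ n, a n ≤ C := by
  obtain ⟨M, hM⟩ := ((Finset.range T).image a).exists_le
  refine ⟨max M (b / (1 - ρ)), fun n => ?_⟩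
  induction n using Nat.strong_induction_on with
  | _ n ih =>
    rcases lt_or_ge n T with hn | hn
    · exact (hM _ (Finset.mem_image_of_mem a (Finset.mem_range.2 hn))).trans (le_max_left _ _)
    · obtain ⟨k, rfl⟩ := Nat.exists_eq_add_of_le' hn
      have h1 := ih k (by omega)
      have h2 : b ≤ (1 - ρ) * max M (b / (1 - ρ)) := by
        rw [← div_le_iff₀' (by linarith)]
        exact le_max_right _ _
      nlinarith [h k, mul_le_mul_of_nonneg_left h1 hρ0]

section Consensus

variable {ι : Type*} [Fintype ι]

/-- The backward product `W (n + k - 1) * ⋯ * W n` of `k` consecutive mixing matrices. -/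
def transitionMatrix [DecidableEq ι] (W : ℕ → ι → ι → ℝ) (n : ℕ) : ℕ → ι → ι → ℝ
  | 0 => fun i j => if i = j then 1 else 0
  | k + 1 => fun i j => ∑ l, W (n + k) i l * transitionMatrix W n k l j

theorem transitionMatrix_eq_zero_or_le [DecidableEq ι] {W : ℕ → ι → ι → ℝ} {θ : ℝ}
    (hθ : 0 < θ) (hW : ∀ n i j, W n i j = 0 ∨ θ ≤ W n i j) (n k : ℕ) (i j : ι) :
    transitionMatrix W n k i j = 0 ∨ θ ^ k ≤ transitionMatrix W n k i j := by
  induction k generalizing i j with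
  | zero =>
    by_cases h : i = j
    · right; simp [transitionMatrix, h]
    · left; simp [transitionMatrix, h]
  | succ k ih =>
    have hWn : ∀ l, 0 ≤ W (n + k) i l := fun l => by
      rcases hW (n + k) i l with h | h <;> linarith
    have hPn : ∀ l, 0 ≤ transitionMatrix W n k l j := fun l => by
      rcases ih l j with h | h
      · exact h.ge
      · exact (pow_pos hθ k).le.trans h
    simp only [transitionMatrix]
    by_cases h : ∃ l, W (n + k) i l * transitionMatrix W n k l j ≠ 0
    · obtain ⟨l, hl⟩ := h
      right
      calc θ ^ (k + 1) = θ * θ ^ k := pow_succ' _ _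
        _ ≤ W (n + k) i l * transitionMatrix W n k l j :=
          mul_le_mul ((hW _ i l).resolve_left (left_ne_zero_of_mul hl))
            ((ih l j).resolve_left (right_ne_zero_of_mul hl)) (by positivity) (hWn l)
        _ ≤ _ := Finset.single_le_sum
          (f := fun l => W (n + k) i l * transitionMatrix W n k l j)
          (fun l _ => mul_nonneg (hWn l) (hPn l)) (Finset.mem_univ l)
    · left
      push Not at h
      exact Finset.sum_eq_zero fun l _ => h l

theorem transitionMatrix_nonneg [DecidableEq ι] {W : ℕ → ι → ι → ℝ}
    (hW : ∀ n i j, 0 ≤ W n i j) (n k : ℕ) (i j : ι) : 0 ≤ transitionMatrix W n k i j := by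
  induction k generalizing i j with
  | zero => by_cases h : i = j <;> simp [transitionMatrix, h]
  | succ k ih =>
    simp only [transitionMatrix]
    exact Finset.sum_nonneg fun l _ => mul_nonneg (hW _ _ _) (ih _ _)

theorem transitionMatrix_succ_pos [DecidableEq ι] {W : ℕ → ι → ι → ℝ}
    (hW : ∀ n i j, 0 ≤ W n i j) {n k : ℕ} {i j l : ι} (hij : 0 < W (n + k) i l)
    (hl : 0 < transitionMatrix W n k l j) : 0 < transitionMatrix W n (k + 1) i j := by
  simp only [transitionMatrix]
  exact Finset.sum_pos' (fun l _ => mul_nonneg (hW _ _ _) (transitionMatrix_nonneg hW _ _ _ _))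
    ⟨l, Finset.mem_univ _, mul_pos hij hl⟩

theorem sum_transitionMatrix_col [DecidableEq ι] {W : ℕ → ι → ι → ℝ}
    (hW : ∀ n j, ∑ i, W n i j = 1) (n k : ℕ) (j : ι) :
    ∑ i, transitionMatrix W n k i j = 1 := by
  induction k with
  | zero => simp [transitionMatrix]
  | succ k ih =>
    simp only [transitionMatrix]
    rw [Finset.sum_comm]
    simp only [← Finset.sum_mul, hW, one_mul, ih]

theorem transitionMatrix_pos [DecidableEq ι] {W : ℕ → ι → ι → ℝ}
    (hW : ∀ n i j, 0 ≤ W n i j) (hdiag : ∀ n i, 0 < W n i i) {D : ℕ}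
    (hconn : ∀ n a b, Relation.ReflTransGen
      (fun u v : ι => ∃ l ∈ Finset.Ico n (n + D), 0 < W l v u) a b) (n : ℕ) (i j : ι) :
    0 < transitionMatrix W n (D * Fintype.card ι) i j := by
  classical
  let S : ℕ → Finset ι := fun k => Finset.univ.filter fun i => 0 < transitionMatrix W n k i j
  have hS : Monotone S := monotone_nat_of_le_succ fun k i hi => by
    simp only [S, Finset.mem_filter, Finset.mem_univ, true_and] at hi ⊢
    exact transitionMatrix_succ_pos hW (hdiag _ i) hi
  have h0 : j ∈ S 0 := Finset.mem_filter.2 ⟨Finset.mem_univ j, by simp [transitionMatrix]⟩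
  have hstep : ∀ k, S k = S (k + D) → S k = Finset.univ := fun k hk => by
    refine Finset.eq_univ_of_forall fun i => ?_
    induction hconn (n + k) j i with
    | refl => exact hS (Nat.zero_le k) h0
    | @tail b c _ hbc ih =>
      obtain ⟨l, hl, hpos⟩ := hbc
      rw [Finset.mem_Ico] at hl
      obtain ⟨q, rfl⟩ := Nat.exists_eq_add_of_le hl.1
      have hb := hS (Nat.le_add_right k q) ih
      rw [hk]
      refine hS (show k + q + 1 ≤ k + D by omega) ?_
      simp only [S, Finset.mem_filter, Finset.mem_univ, true_and] at hb ⊢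
      exact transitionMatrix_succ_pos hW (by rwa [← add_assoc]) hb
  have hcard : ∀ s, S (D * s) = Finset.univ ∨ s + 1 ≤ (S (D * s)).card := fun s => by
    induction s with
    | zero => exact Or.inr (Finset.card_pos.2 ⟨j, h0⟩)
    | succ s ih =>
      have hsub : S (D * s) ⊆ S (D * (s + 1)) := hS (Nat.mul_le_mul_left D (by omega))
      by_cases he : S (D * s) = S (D * (s + 1))
      · exact Or.inl (he ▸ hstep _ (by rw [he, mul_add, mul_one]))
      · rcases ih with ih | ih
        · exact Or.inl (Finset.univ_subset_iff.1 (ih ▸ hsub))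
        · have := Finset.card_lt_card (hsub.ssubset_of_ne he)
          exact Or.inr (by omega)
  have hfin : S (D * Fintype.card ι) = Finset.univ := by
    refine (hcard _).resolve_right fun h => ?_
    have := Finset.card_le_univ (S (D * Fintype.card ι))
    omega
  have := Finset.mem_univ i
  rw [← hfin] at this
  simpa [S] using this

variable {E : Type*} [NormedAddCommGroup E] [NormedSpace ℝ E]

/-- The average of a finite family of vectors. -/
noncomputable def familyAverage (v : ι → E) : E := (Fintype.card ι : ℝ)⁻¹ • ∑ j, v j

/-- The total deviation of a finite family of vectors from its average. -/
noncomputable def disagreement (v : ι → E) : ℝ := ∑ i, ‖v i - familyAverage v‖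

theorem disagreement_nonneg (v : ι → E) : 0 ≤ disagreement v :=
  Finset.sum_nonneg fun _ _ => norm_nonneg _

theorem norm_sub_familyAverage_le_disagreement (v : ι → E) (i : ι) :
    ‖v i - familyAverage v‖ ≤ disagreement v :=
  Finset.single_le_sum (f := fun i => ‖v i - familyAverage v‖) (fun _ _ => norm_nonneg _)
    (Finset.mem_univ i)

theorem card_smul_familyAverage [Nonempty ι] (v : ι → E) :
    (Fintype.card ι : ℝ) • familyAverage v = ∑ j, v j := by
  rw [familyAverage, smul_inv_smul₀ (by simp)]

theorem sum_sub_familyAverage [Nonempty ι] (v : ι → E) : ∑ i, (v i - familyAverage v) = 0 := by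
  rw [Finset.sum_sub_distrib, Finset.sum_const, Finset.card_univ, ← Nat.cast_smul_eq_nsmul ℝ,
    card_smul_familyAverage, sub_self]

theorem disagreement_le_two_mul [Nonempty ι] (v : ι → E) : disagreement v ≤ 2 * ∑ i, ‖v i‖ := by
  have h : (Fintype.card ι : ℝ) * ‖familyAverage v‖ ≤ ∑ i, ‖v i‖ := by
    rw [← Real.norm_natCast, ← norm_smul, card_smul_familyAverage]
    exact norm_sum_le _ _
  calc disagreement v ≤ ∑ i, (‖v i‖ + ‖familyAverage v‖) :=
        Finset.sum_le_sum fun i _ => norm_sub_le _ _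
    _ ≤ 2 * ∑ i, ‖v i‖ := by
        rw [Finset.sum_add_distrib, Finset.sum_const, Finset.card_univ, nsmul_eq_mul]
        linarith

theorem sum_norm_sum_smul_le {P : ι → ι → ℝ} {c : ℝ} (hP : ∀ i j, 0 ≤ P i j)
    (hcol : ∀ j, ∑ i, P i j ≤ c) (e : ι → E) :
    ∑ i, ‖∑ j, P i j • e j‖ ≤ c * ∑ j, ‖e j‖ := by
  calc ∑ i, ‖∑ j, P i j • e j‖ ≤ ∑ i, ∑ j, P i j * ‖e j‖ :=
        Finset.sum_le_sum fun i _ => (norm_sum_le _ _).trans_eq <| Finset.sum_congr rfl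
          fun j _ => by rw [norm_smul, Real.norm_of_nonneg (hP i j)]
    _ = ∑ j, (∑ i, P i j) * ‖e j‖ := by
        rw [Finset.sum_comm]
        simp only [Finset.sum_mul]
    _ ≤ c * ∑ j, ‖e j‖ := by
        rw [Finset.mul_sum]
        exact Finset.sum_le_sum fun j _ => mul_le_mul_of_nonneg_right (hcol j) (norm_nonneg _)

theorem norm_familyAverage_le [Nonempty ι] {v : ι → E} {C : ℝ} (h : ∀ i, ‖v i‖ ≤ C) :
    ‖familyAverage v‖ ≤ C := by
  have h1 : (Fintype.card ι : ℝ) * ‖familyAverage v‖ ≤ Fintype.card ι * C := by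
    rw [← Real.norm_natCast, ← norm_smul, card_smul_familyAverage, Real.norm_natCast]
    simpa using norm_sum_le_of_le Finset.univ fun i _ => h i
  exact le_of_mul_le_mul_left h1 (by exact_mod_cast Fintype.card_pos)

theorem familyAverage_mix {P : ι → ι → ℝ} (hcol : ∀ j, ∑ i, P i j = 1) (v δ : ι → E) :
    familyAverage (fun i => ∑ j, P i j • v j + δ i) = familyAverage v + familyAverage δ := by
  simp only [familyAverage, ← smul_add, Finset.sum_add_distrib]
  rw [Finset.sum_comm]
  simp only [← Finset.sum_smul, hcol, one_smul]

theorem exists_sub_familyAverage_eq_transitionMatrix [DecidableEq ι] [Nonempty ι]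
    {W : ℕ → ι → ι → ℝ} (hW : ∀ n i j, 0 ≤ W n i j) (hrow : ∀ n i, ∑ j, W n i j = 1)
    (hcol : ∀ n j, ∑ i, W n i j = 1) {v δ : ℕ → ι → E}
    (hv : ∀ n i, v (n + 1) i = ∑ j, W n i j • v n j + δ n i) (n k : ℕ) :
    ∃ q : ι → E, (∀ i, v (n + k) i - familyAverage (v (n + k))
        = ∑ j, transitionMatrix W n k i j • (v n j - familyAverage (v n)) + q i) ∧
      ∑ i, ‖q i‖ ≤ ∑ l ∈ Finset.range k, 2 * ∑ i, ‖δ (n + l) i‖ := by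
  induction k with
  | zero => exact ⟨0, fun i => by simp [transitionMatrix], by simp⟩
  | succ k ih =>
    obtain ⟨q, hq, hqs⟩ := ih
    refine ⟨fun i => ∑ j, W (n + k) i j • q j
      + (δ (n + k) i - familyAverage (δ (n + k))), fun i => ?_, ?_⟩
    · have h1 : familyAverage (v (n + (k + 1)))
          = familyAverage (v (n + k)) + familyAverage (δ (n + k)) := by
        rw [← familyAverage_mix (hcol (n + k)) (v (n + k)) (δ (n + k))]
        congr 1
        ext1 i
        exact hv (n + k) i
      have h2 : ∑ j, W (n + k) i j • (v (n + k) j - familyAverage (v (n + k)))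
          = ∑ j, W (n + k) i j • v (n + k) j - familyAverage (v (n + k)) := by
        simp only [smul_sub, Finset.sum_sub_distrib, ← Finset.sum_smul, hrow, one_smul]
      have h3 : ∑ j, transitionMatrix W n (k + 1) i j • (v n j - familyAverage (v n))
          = ∑ l, W (n + k) i l •
              ∑ j, transitionMatrix W n k l j • (v n j - familyAverage (v n)) := by
        simp only [transitionMatrix, Finset.sum_smul, Finset.smul_sum, mul_smul]
        exact Finset.sum_comm
      have h4 : v (n + (k + 1)) i = ∑ j, W (n + k) i j • v (n + k) j + δ (n + k) i := hv (n + k) i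
      rw [h1, h4, h3, ← add_assoc, ← Finset.sum_add_distrib]
      simp only [← smul_add, ← hq, h2]
      abel
    · rw [Finset.sum_range_succ]
      calc ∑ i, ‖∑ j, W (n + k) i j • q j + (δ (n + k) i - familyAverage (δ (n + k)))‖
          ≤ ∑ i, (‖∑ j, W (n + k) i j • q j‖ + ‖δ (n + k) i - familyAverage (δ (n + k))‖) :=
            Finset.sum_le_sum fun i _ => norm_add_le _ _
        _ = ∑ i, ‖∑ j, W (n + k) i j • q j‖ + disagreement (δ (n + k)) := by
            rw [Finset.sum_add_distrib, disagreement]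
        _ ≤ _ := add_le_add ((sum_norm_sum_smul_le (hW _) (fun j => (hcol _ j).le) q).trans
            (by rwa [one_mul])) (disagreement_le_two_mul _)

theorem exists_disagreement_contraction [Nonempty ι] {W : ℕ → ι → ι → ℝ} {θ : ℝ}
    (hθ : 0 < θ) (hθ1 : θ ≤ 1) (hW : ∀ n i j, W n i j = 0 ∨ θ ≤ W n i j)
    (hdiag : ∀ n i, θ ≤ W n i i) (hrow : ∀ n i, ∑ j, W n i j = 1)
    (hcol : ∀ n j, ∑ i, W n i j = 1) {D : ℕ} (hD : 0 < D)
    (hconn : ∀ n a b, Relation.ReflTransGen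
      (fun u v : ι => ∃ l ∈ Finset.Ico n (n + D), 0 < W l v u) a b) :
    ∃ (T : ℕ) (ρ : ℝ), 0 < T ∧ 0 ≤ ρ ∧ ρ < 1 ∧ ∀ v δ : ℕ → ι → E,
      (∀ n i, v (n + 1) i = ∑ j, W n i j • v n j + δ n i) → ∀ n,
        disagreement (v (n + T)) ≤ ρ * disagreement (v n)
          + ∑ l ∈ Finset.range T, 2 * ∑ i, ‖δ (n + l) i‖ := by
  classical
  have hW0 : ∀ n i j, 0 ≤ W n i j := fun n i j => by
    rcases hW n i j with h | h <;> linarith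
  set T := D * Fintype.card ι
  have hη0 : 0 < θ ^ T := pow_pos hθ T
  have hη1 : θ ^ T ≤ 1 := pow_le_one₀ hθ.le hθ1
  refine ⟨T, 1 - θ ^ T, Nat.mul_pos hD Fintype.card_pos, by linarith, by linarith,
    fun v δ hv n => ?_⟩
  obtain ⟨q, hq, hqs⟩ := exists_sub_familyAverage_eq_transitionMatrix hW0 hrow hcol hv n T
  set P := transitionMatrix W n T
  have hP : ∀ i j, θ ^ T ≤ P i j := fun i j =>
    (transitionMatrix_eq_zero_or_le hθ hW n T i j).resolve_left
      (transitionMatrix_pos hW0 (fun n i => hθ.trans_le (hdiag n i)) hconn n i j).ne'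
  have h1 : ∀ i, ∑ j, P i j • (v n j - familyAverage (v n))
      = ∑ j, (P i j - θ ^ T) • (v n j - familyAverage (v n)) := fun i => by
    simp only [sub_smul, Finset.sum_sub_distrib]
    rw [← Finset.smul_sum, sum_sub_familyAverage, smul_zero, sub_zero]
  calc disagreement (v (n + T))
      ≤ ∑ i, (‖∑ j, (P i j - θ ^ T) • (v n j - familyAverage (v n))‖
          + ‖q i‖) := Finset.sum_le_sum fun i _ => by
        rw [hq, h1]
        exact norm_add_le _ _
    _ ≤ (1 - θ ^ T) * disagreement (v n) + ∑ l ∈ Finset.range T, 2 * ∑ i, ‖δ (n + l) i‖ := by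
        rw [Finset.sum_add_distrib]
        refine add_le_add (sum_norm_sum_smul_le
          (P := fun i j => P i j - θ ^ T) (fun i j => ?_) (fun j => ?_) _) hqs
        · simpa using hP i j
        · simp only [Finset.sum_sub_distrib]
          rw [sum_transitionMatrix_col hcol, Finset.sum_const, Finset.card_univ, nsmul_eq_mul]
          have : (1 : ℝ) ≤ Fintype.card ι := by exact_mod_cast Fintype.card_pos (α := ι)
          nlinarith

theorem disagreement_bounded_and_summable [Nonempty ι] {W : ℕ → ι → ι → ℝ} {θ : ℝ}
    (hθ : 0 < θ) (hθ1 : θ ≤ 1) (hW : ∀ n i j, W n i j = 0 ∨ θ ≤ W n i j)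
    (hdiag : ∀ n i, θ ≤ W n i i) (hrow : ∀ n i, ∑ j, W n i j = 1)
    (hcol : ∀ n j, ∑ i, W n i j = 1) {D : ℕ} (hD : 0 < D)
    (hconn : ∀ n a b, Relation.ReflTransGen
      (fun u v : ι => ∃ l ∈ Finset.Ico n (n + D), 0 < W l v u) a b) {v δ : ℕ → ι → E}
    (hv : ∀ n i, v (n + 1) i = ∑ j, W n i j • v n j + δ n i) :
    ((∃ C, ∀ n, ∑ i, ‖δ n i‖ ≤ C) → ∃ C, ∀ n, disagreement (v n) ≤ C) ∧
      ((Summable fun n => (∑ i, ‖δ n i‖) ^ 2) → Summable fun n => disagreement (v n) ^ 2) := by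
  obtain ⟨T, ρ, hT, hρ0, hρ1, h⟩ :=
    exists_disagreement_contraction (E := E) hθ hθ1 hW hdiag hrow hcol hD hconn
  refine ⟨fun ⟨C, hC⟩ => ?_, fun hs => ?_⟩
  · refine exists_forall_le_of_le_mul_add_of_shift (b := ∑ l ∈ Finset.range T, 2 * C) hT hρ0 hρ1
      fun n => (h v δ hv n).trans ?_
    gcongr
    exact hC _
  · refine summable_sq_of_le_mul_add_of_shift (fun n => disagreement_nonneg _) ?_ hρ0 hρ1
      (h v δ hv)
    have h1 : Summable fun n => (T : ℝ) * ∑ l ∈ Finset.range T, (2 * ∑ i, ‖δ (n + l) i‖) ^ 2 := by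
      refine Summable.mul_left _ (summable_sum fun l _ => ?_)
      simp only [mul_pow]
      exact ((summable_nat_add_iff (f := fun n => (∑ i, ‖δ n i‖) ^ 2) l).2 hs).mul_left _
    refine h1.of_nonneg_of_le (fun n => sq_nonneg _) fun n => ?_
    simpa using sq_sum_le_card_mul_sum_sq (s := Finset.range T)
      (f := fun l => 2 * ∑ i, ‖δ (n + l) i‖)

end Consensus

theorem summable_and_bounded_of_add_le_add {u p s : ℕ → ℝ} {c : ℝ} (hu : ∀ n, c ≤ u n)
    (hp : ∀ n, 0 ≤ p n) (hs : ∀ n, 0 ≤ s n) (hss : Summable s)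
    (h : ∀ n, u (n + 1) + p n ≤ u n + s n) : Summable p ∧ ∃ C, ∀ n, u n ≤ C := by
  have key : ∀ N, u N + ∑ n ∈ Finset.range N, p n ≤ u 0 + ∑ n ∈ Finset.range N, s n := fun N => by
    induction N with
    | zero => simp
    | succ N ih =>
      rw [Finset.sum_range_succ, Finset.sum_range_succ]
      linarith [h N]
  have hle : ∀ N, ∑ n ∈ Finset.range N, s n ≤ ∑' n, s n := fun N =>
    hss.sum_le_tsum _ fun i _ => hs i
  refine ⟨summable_of_sum_range_le (c := u 0 + ∑' n, s n - c) hp fun N => ?_,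
    u 0 + ∑' n, s n, fun N => ?_⟩
  · linarith [key N, hle N, hu N]
  · linarith [key N, hle N, Finset.sum_nonneg (s := Finset.range N) fun n _ => hp n]

theorem tendsto_zero_of_summable_mul_sq {α d e : ℕ → ℝ} {C : ℝ} (hC : 0 < C)
    (hα : ∀ n, 0 ≤ α n) (hαdiv : ¬ Summable α) (hd : ∀ n, 0 ≤ d n)
    (hs : Summable fun n => α n * d n ^ 2) (he : Tendsto e atTop (nhds 0))
    (h : ∀ n k, d n ≤ d (n + k) + C * ∑ l ∈ Finset.range k, α (n + l) + e n + e (n + k)) :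
    Tendsto d atTop (nhds 0) := by
  rw [Metric.tendsto_atTop]
  intro δ hδ
  have h1 : ∀ᶠ n in atTop, e n < δ / 8 := he.eventually_lt_const (by positivity)
  have h2 : ∀ᶠ n in atTop, ∑' l, α (l + n) * d (l + n) ^ 2 < δ ^ 3 / (16 * C) :=
    (tendsto_sum_nat_add fun n => α n * d n ^ 2).eventually_lt_const (by positivity)
  obtain ⟨N, hN⟩ := eventually_atTop.1 (h1.and h2)
  refine ⟨N, fun n hn => ?_⟩
  rw [Real.dist_0_eq_abs, abs_of_nonneg (hd n)]
  by_contra! hcon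
  have hdiv : Tendsto (fun k => ∑ l ∈ Finset.range k, α (n + l)) atTop atTop := by
    refine (not_summable_iff_tendsto_nat_atTop_of_nonneg fun l => hα _).1 fun hsum => hαdiv ?_
    rw [← summable_nat_add_iff n]
    simpa [add_comm] using hsum
  have hex : ∃ k, δ / (4 * C) < ∑ l ∈ Finset.range k, α (n + l) :=
    (hdiv.eventually_gt_atTop _).exists
  classical
  set k := Nat.find hex
  have hk : δ / (4 * C) < ∑ l ∈ Finset.range k, α (n + l) := Nat.find_spec hex
  have hlow : ∀ l ∈ Finset.range k, δ ^ 2 / 4 * α (n + l) ≤ α (n + l) * d (n + l) ^ 2 := by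
    intro l hl
    have h3 := not_lt.1 (Nat.find_min hex (Finset.mem_range.1 hl))
    rw [le_div_iff₀ (by positivity)] at h3
    have h4 := h n l
    have h5 := (hN n hn).1
    have h6 := (hN (n + l) (by omega)).1
    have h7 : δ / 2 ≤ d (n + l) := by linarith
    have h8 : (δ / 2) ^ 2 ≤ d (n + l) ^ 2 := pow_le_pow_left₀ (by positivity) h7 2
    nlinarith [hα (n + l)]
  have h3 := Finset.sum_le_sum hlow
  rw [← Finset.mul_sum] at h3
  have hs' : Summable fun l => α (l + n) * d (l + n) ^ 2 :=
    (summable_nat_add_iff (f := fun n => α n * d n ^ 2) n).2 hs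
  have h4 := hs'.sum_le_tsum (Finset.range k) fun l _ => mul_nonneg (hα _) (sq_nonneg _)
  have h5 := (hN n hn).2
  have h6 : δ ^ 3 / (16 * C) = δ ^ 2 / 4 * (δ / (4 * C)) := by
    field_simp
    norm_num
  have h7 : δ ^ 2 / 4 * (δ / (4 * C)) < δ ^ 2 / 4 * ∑ l ∈ Finset.range k, α (n + l) := by gcongr
  simp only [add_comm _ n] at h4 h5
  linarith

theorem summable_mul_of_summable_sq {a b : ℕ → ℝ} (ha : ∀ n, 0 ≤ a n) (hb : ∀ n, 0 ≤ b n)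
    (has : Summable fun n => a n ^ 2) (hbs : Summable fun n => b n ^ 2) :
    Summable fun n => a n * b n :=
  (has.add hbs).of_nonneg_of_le (fun n => mul_nonneg (ha n) (hb n)) fun n => by
    nlinarith [sq_nonneg (a n - b n), sq_nonneg (a n), sq_nonneg (b n)]

theorem tendsto_zero_of_summable_sq {a : ℕ → ℝ} (has : Summable fun n => a n ^ 2) :
    Tendsto a atTop (nhds 0) := by
  have := has.tendsto_atTop_zero
  rw [tendsto_zero_iff_abs_tendsto_zero]
  simpa [Real.sqrt_sq_eq_abs, Function.comp_def] using this.sqrt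

section BestResponse

variable {E : Type*} [NormedAddCommGroup E] [InnerProductSpace ℝ E] {K : Set E}

theorem StrongConvexOn.add_inner_add_growth {φ G : E → ℝ} {m : ℝ} (hφ : StrongConvexOn K m φ)
    (hG : ConvexOn ℝ Set.univ G) {w z q u : E} (hz : z ∈ K) (hu : u ∈ K)
    (hmin : ∀ v ∈ K, φ z + ⟪q, z - w⟫_ℝ + G z ≤ φ v + ⟪q, v - w⟫_ℝ + G v) :
    φ z + ⟪q, z - w⟫_ℝ + G z + m / 2 * ‖z - u‖ ^ 2 ≤ φ u + ⟪q, u - w⟫_ℝ + G u := by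
  have hs : StrongConvexOn K m fun v => φ v + ⟪q, v - w⟫_ℝ + G v := by
    refine ⟨hφ.1, fun a ha b hb s t hs ht hst => ?_⟩
    have h1 := hφ.2 ha hb hs ht hst
    have h2 := hG.2 (Set.mem_univ a) (Set.mem_univ b) hs ht hst
    have h3 : ⟪q, s • a + t • b - w⟫_ℝ = s * ⟪q, a - w⟫_ℝ + t * ⟪q, b - w⟫_ℝ := by
      obtain rfl : s = 1 - t := by linarith
      simp only [inner_sub_right, inner_add_right, inner_smul_right]
      ring
    simp only [smul_eq_mul] at h1 h2 ⊢
    rw [h3]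
    linarith
  exact hs.add_sq_le_of_isMinOn hz hu hmin

theorem StrongConvexOn.descent_of_isMin [CompleteSpace E] {φ G : E → ℝ} {m : ℝ}
    (hφ : StrongConvexOn K m φ) (hG : ConvexOn ℝ Set.univ G) {g w z q : E}
    (hg : HasGradientAt φ g w) (hw : w ∈ K) (hz : z ∈ K)
    (hmin : ∀ v ∈ K, φ z + ⟪q, z - w⟫_ℝ + G z ≤ φ v + ⟪q, v - w⟫_ℝ + G v) :
    m * ‖z - w‖ ^ 2 + ⟪g + q, z - w⟫_ℝ + G z ≤ G w := by
  have h1 := hφ.add_inner_add_growth hG hz hw hmin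
  have h2 := hφ.add_inner_add_le hw hz hg
  rw [norm_sub_rev] at h2
  rw [sub_self, inner_zero_right] at h1
  rw [inner_add_left]
  linarith

theorem StrongConvexOn.mul_norm_sub_le_of_isMin [CompleteSpace E] {φ₁ φ₂ G : E → ℝ}
    {g₁ g₂ : E → E} {m C : ℝ} (hK : Convex ℝ K) (hφ₁ : StrongConvexOn K m φ₁)
    (hφ₂ : StrongConvexOn K m φ₂) (hG : ConvexOn ℝ Set.univ G) {w₁ w₂ z₁ z₂ q₁ q₂ : E}
    (h₁ : ∀ z ∈ K, HasGradientAt φ₁ (g₁ z) z) (h₂ : ∀ z ∈ K, HasGradientAt φ₂ (g₂ z) z)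
    (hC : ∀ z ∈ K, ‖g₁ z - g₂ z‖ ≤ C) (hz₁ : z₁ ∈ K) (hz₂ : z₂ ∈ K)
    (hmin₁ : ∀ v ∈ K, φ₁ z₁ + ⟪q₁, z₁ - w₁⟫_ℝ + G z₁ ≤ φ₁ v + ⟪q₁, v - w₁⟫_ℝ + G v)
    (hmin₂ : ∀ v ∈ K, φ₂ z₂ + ⟪q₂, z₂ - w₂⟫_ℝ + G z₂ ≤ φ₂ v + ⟪q₂, v - w₂⟫_ℝ + G v) :
    m * ‖z₁ - z₂‖ ≤ C + ‖q₁ - q₂‖ := by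
  have hC0 : 0 ≤ C := (norm_nonneg _).trans (hC z₁ hz₁)
  rcases (norm_nonneg (z₁ - z₂)).eq_or_lt with h0 | hpos
  · rw [← h0, mul_zero]
    positivity
  have e1 := hφ₁.add_inner_add_growth hG hz₁ hz₂ hmin₁
  have e2 := hφ₂.add_inner_add_growth hG hz₂ hz₁ hmin₂
  have e3 := le_of_abs_le (abs_sub_sub_sub_le_of_gradient_sub_le hK h₁ h₂ hC hz₁ hz₂)
  have e4 := (abs_le.1 (abs_real_inner_le_norm (q₁ - q₂) (z₁ - z₂))).1
  rw [norm_sub_rev z₂ z₁] at e2 e3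
  simp only [inner_sub_left, inner_sub_right] at e1 e2 e4
  refine le_of_mul_le_mul_right ?_ hpos
  nlinarith

theorem ConvexOn.le_inner_add_of_forall_le [CompleteSpace E] {φ G : E → ℝ} (hK : Convex ℝ K)
    (hG : ConvexOn ℝ Set.univ G) {g p q : E} (hp : p ∈ K) (hg : HasGradientAt φ g p)
    (h : ∀ u ∈ K, φ p - φ u ≤ ⟪q, u - p⟫_ℝ + G u - G p) :
    ∀ v ∈ K, G p ≤ ⟪g + q, v - p⟫_ℝ + G v := by
  intro v hv
  have := (hg.hasDerivAt_add_smul (v - p)).neg.le_of_forall_le_add_mul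
    (A := ⟪q, v - p⟫_ℝ + G v - G p) (C := 0) fun t ht => by
      have h1 := h _ (hK.add_smul_sub_mem hp hv ⟨ht.1.le, ht.2.le⟩)
      have h2 := hG.2 (Set.mem_univ p) (Set.mem_univ v) (sub_nonneg.2 ht.2.le) ht.1.le
        (sub_add_cancel 1 t)
      have h3 : (1 - t) • p + t • v = p + t • (v - p) := by module
      rw [h3] at h2
      rw [add_sub_cancel_left, inner_smul_right] at h1
      simp only [smul_eq_mul, Pi.neg_apply, zero_smul, add_zero, mul_zero] at h2 ⊢
      linarith
  rw [inner_add_left]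
  linarith

end BestResponse

set_option maxHeartbeats 4000000 in
/-- Convergence of the inexact NEXT algorithm: boundedness of the average sequence, stationarity of its limit points, and asymptotic consensus. -/
theorem stmt_10 {m I : ℕ} (hI : 0 < I)
    (K : Set (EuclideanSpace ℝ (Fin m)))
    (hKne : K.Nonempty) (hKcl : IsClosed K) (hKcv : Convex ℝ K)
    (f : Fin I → EuclideanSpace ℝ (Fin m) → ℝ)
    (gf : Fin I → EuclideanSpace ℝ (Fin m) → EuclideanSpace ℝ (Fin m))
    (Uo : Set (EuclideanSpace ℝ (Fin m))) (hUo : IsOpen Uo) (hKUo : K ⊆ Uo)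
    (hdiff : ∀ i, ∀ x ∈ Uo, HasGradientAt (f i) (gf i x) x)
    (hgradcont : ∀ i, ContinuousOn (gf i) Uo)
    (L : Fin I → ℝ)
    (hLip : ∀ i, ∀ x ∈ K, ∀ y ∈ K, ‖gf i x - gf i y‖ ≤ L i * ‖x - y‖)
    (LF : ℝ) (hLF : 0 < LF)
    (hgb : ∀ i, ∀ x ∈ K, ‖gf i x‖ ≤ LF)
    (G : EuclideanSpace ℝ (Fin m) → ℝ) (hG : ConvexOn ℝ Set.univ G)
    (LG : ℝ)
    (hsub : ∀ x ∈ K, ∀ g, (∀ y, G x + ⟪g, y - x⟫_ℝ ≤ G y) → ‖g‖ ≤ LG)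
    (hcoer : ∀ c : ℝ, ∃ r : ℝ, ∀ x ∈ K, r ≤ ‖x‖ → c ≤ (∑ i, f i x) + G x)
    (ft : Fin I → EuclideanSpace ℝ (Fin m) → EuclideanSpace ℝ (Fin m) → ℝ)
    (gft : Fin I → EuclideanSpace ℝ (Fin m) → EuclideanSpace ℝ (Fin m) → EuclideanSpace ℝ (Fin m))
    (τ : Fin I → ℝ) (hτ : ∀ i, 0 < τ i)
    (hF1 : ∀ i, ∀ z ∈ K, StrongConvexOn K (τ i) (fun x => ft i x z))
    (hftgrad : ∀ i, ∀ z ∈ K, ∀ x ∈ K, HasGradientAt (fun u => ft i u z) (gft i x z) x)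
    (hF2 : ∀ i, ∀ x ∈ K, gft i x x = gf i x)
    (Lt : ℝ)
    (hF3 : ∀ i, ∀ x ∈ K, ∀ w ∈ K, ∀ z ∈ K, ‖gft i x w - gft i x z‖ ≤ Lt * ‖w - z‖)
    (θ : ℝ) (hθ : θ ∈ Set.Ioo (0 : ℝ) 1)
    (W : ℕ → Fin I → Fin I → ℝ)
    (hWentries : ∀ n i j, W n i j = 0 ∨ W n i j ∈ Set.Icc θ 1)
    (hWdiag : ∀ n i, θ ≤ W n i i)
    (hWrow : ∀ n i, ∑ j, W n i j = 1)
    (hWcol : ∀ n j, ∑ i, W n i j = 1)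
    (B : ℕ) (hB : 0 < B)
    (hconn : ∀ k : ℕ, ∀ a b : Fin I,
      Relation.ReflTransGen
        (fun u v : Fin I => ∃ n ∈ Finset.Ico (k * B) ((k + 1) * B), 0 < W n v u) a b)
    (α : ℕ → ℝ) (hα : ∀ n, α n ∈ Set.Ioc (0 : ℝ) 1)
    (hαdiv : ¬ Summable α)
    (hαsq : Summable (fun n => (α n) ^ 2))
    (x xt y πt : Fin I → ℕ → EuclideanSpace ℝ (Fin m))
    (hx0 : ∀ i, x i 0 ∈ K)
    (hy0 : ∀ i, y i 0 = gf i (x i 0))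
    (hπt : ∀ i n, πt i n = (I : ℝ) • y i n - gf i (x i n))
    (hxt : ∀ i n, xt i n ∈ K ∧ ∀ u ∈ K, u ≠ xt i n →
      ft i (xt i n) (x i n) + ⟪πt i n, xt i n - x i n⟫_ℝ + G (xt i n)
        < ft i u (x i n) + ⟪πt i n, u - x i n⟫_ℝ + G u)
    (hyrec : ∀ i n, y i (n + 1) = (∑ j, W n i j • y j n) + gf i (x i (n + 1)) - gf i (x i n))
    (ε : Fin I → ℕ → ℝ) (hεnn : ∀ i n, 0 ≤ ε i n)
    (hεbd : ∃ Cb : ℝ, ∀ i n, ε i n ≤ Cb)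
    (hεsum : ∀ i, Summable (fun n => α n * ε i n))
    (xinx : Fin I → ℕ → EuclideanSpace ℝ (Fin m))
    (hinx : ∀ i n, xinx i n ∈ K ∧ ‖xinx i n - xt i n‖ ≤ ε i n)
    (hxrec : ∀ i n, x i (n + 1) = ∑ j, W n i j • (x j n + α n • (xinx j n - x j n)))
    (xbar : ℕ → EuclideanSpace ℝ (Fin m)) (hxbar : ∀ n, xbar n = (I : ℝ)⁻¹ • ∑ j, x j n) :
    ((∃ R : ℝ, ∀ n, ‖xbar n‖ ≤ R) ∧
      (∀ p, MapClusterPt p Filter.atTop xbar →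
        p ∈ K ∧ ∃ g, (∀ y, G p + ⟪g, y - p⟫_ℝ ≤ G y) ∧
          ∀ y ∈ K, 0 ≤ ⟪(∑ j, gf j p) + g, y - p⟫_ℝ)) ∧
    (∀ i, Filter.Tendsto (fun n => ‖x i n - xbar n‖) Filter.atTop (nhds 0)) := by
  classical
  have : Nonempty (Fin I) := ⟨⟨0, hI⟩⟩
  have hIpos : (0 : ℝ) < I := by exact_mod_cast hI
  obtain ⟨hθ0, hθ1⟩ := hθ
  have hW : ∀ n i j, W n i j = 0 ∨ θ ≤ W n i j := fun n i j => (hWentries n i j).imp_right And.left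
  have hW0 : ∀ n i j, 0 ≤ W n i j := fun n i j => by
    rcases hW n i j with h | h <;> linarith
  have hα0 : ∀ n, 0 ≤ α n := fun n => (hα n).1.le
  have hconn' : ∀ n a b, Relation.ReflTransGen
      (fun u v : Fin I => ∃ l ∈ Finset.Ico n (n + 2 * B), 0 < W l v u) a b := fun n a b => by
    refine Relation.ReflTransGen.mono (fun u v ⟨l, hl, hpos⟩ => ⟨l, ?_, hpos⟩) a b
      (hconn (n / B + 1) a b)
    rw [Finset.mem_Ico] at hl ⊢
    have h1 := Nat.div_add_mod n B
    have h2 := Nat.mod_lt n hB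
    rw [mul_comm] at h1
    simp only [add_mul, one_mul] at hl
    omega
  have hmix := fun (v δ : ℕ → Fin I → EuclideanSpace ℝ (Fin m)) hv =>
    disagreement_bounded_and_summable (v := v) (δ := δ) hθ0 hθ1.le hW hWdiag hWrow hWcol
      (D := 2 * B) (by omega) hconn' hv
  have havg : ∀ v : Fin I → EuclideanSpace ℝ (Fin m),
      familyAverage v = (I : ℝ)⁻¹ • ∑ j, v j := fun v => by simp [familyAverage]
  -- feasibility
  have hxK : ∀ n i, x i n ∈ K := fun n => by
    induction n with
    | zero => exact hx0
    | succ n ih =>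
      intro i
      rw [hxrec]
      exact hKcv.sum_mem (fun j _ => hW0 n i j) (hWrow n i) fun j _ =>
        hKcv.add_smul_sub_mem (ih j) (hinx j n).1 ⟨hα0 n, (hα n).2⟩
  have hbarK : ∀ n, xbar n ∈ K := fun n => by
    rw [hxbar, Finset.smul_sum]
    exact hKcv.sum_mem (fun _ _ => by positivity) (by simp [hIpos.ne']) fun j _ => hxK n j
  have hxtK : ∀ i n, xt i n ∈ K := fun i n => (hxt i n).1
  have hmin : ∀ i n, ∀ u ∈ K,
      ft i (xt i n) (x i n) + ⟪πt i n, xt i n - x i n⟫_ℝ + G (xt i n)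
        ≤ ft i u (x i n) + ⟪πt i n, u - x i n⟫_ℝ + G u := fun i n u hu => by
    rcases eq_or_ne u (xt i n) with rfl | h
    · exact le_rfl
    · exact ((hxt i n).2 u hu h).le
  have hgfK : ∀ i, ∀ z ∈ K, HasGradientAt (f i) (gf i z) z := fun i z hz => hdiff i z (hKUo hz)
  have hGL : ∀ a ∈ K, ∀ b ∈ K, |G a - G b| ≤ |LG| * ‖a - b‖ := fun a ha b hb =>
    (hG.abs_sub_le_of_subgradient_norm_le hsub ha hb).trans (by gcongr; exact le_abs_self _)
  obtain ⟨Cb, hCb⟩ := hεbd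
  have hCb0 : 0 ≤ Cb := (hεnn ⟨0, hI⟩ 0).trans (hCb _ _)
  set SL : ℝ := ∑ i, |L i| with hSL
  have hSL0 : 0 ≤ SL := Finset.sum_nonneg fun _ _ => abs_nonneg _
  have hLSL : ∀ i, |L i| ≤ SL := fun i =>
    Finset.single_le_sum (f := fun i => |L i|) (fun _ _ => abs_nonneg _) (Finset.mem_univ i)
  have hLip' : ∀ i, ∀ a ∈ K, ∀ b ∈ K, ‖gf i a - gf i b‖ ≤ |L i| * ‖a - b‖ := fun i a ha b hb =>
    (hLip i a ha b hb).trans (by gcongr; exact le_abs_self _)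
  set gF : EuclideanSpace ℝ (Fin m) → EuclideanSpace ℝ (Fin m) := fun z => ∑ j, gf j z with hgF
  have hgFL : ∀ a ∈ K, ∀ b ∈ K, ‖gF a - gF b‖ ≤ SL * ‖a - b‖ := fun a ha b hb => by
    rw [hgF, hSL, Finset.sum_mul]
    simp only [← Finset.sum_sub_distrib]
    exact norm_sum_le_of_le _ fun i _ => hLip' i a ha b hb
  have hgFb : ∀ a ∈ K, ‖gF a‖ ≤ I * LF := fun a ha => by
    simpa using norm_sum_le_of_le Finset.univ fun i _ => hgb i a ha
  -- gradient tracking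
  set X : ℕ → Fin I → EuclideanSpace ℝ (Fin m) := fun n i => x i n with hX
  set Y : ℕ → Fin I → EuclideanSpace ℝ (Fin m) := fun n i => y i n with hY
  have hXbar : ∀ n, familyAverage (X n) = xbar n := fun n => by rw [havg, hxbar]
  have hYsum : ∀ n, ∑ i, y i n = ∑ i, gf i (x i n) := fun n => by
    induction n with
    | zero => simp only [hy0]
    | succ n ih =>
      simp only [hyrec, Finset.sum_sub_distrib, Finset.sum_add_distrib]
      rw [Finset.sum_comm]
      simp only [← Finset.sum_smul, hWcol, one_smul, ih]
      abel
  have hYavg : ∀ n, (I : ℝ) • familyAverage (Y n) = ∑ i, gf i (x i n) := fun n => by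
    rw [havg, smul_inv_smul₀ hIpos.ne', ← hYsum]
  have hYrec : ∀ n i, Y (n + 1) i = ∑ j, W n i j • Y n j
      + (gf i (x i (n + 1)) - gf i (x i n)) := fun n i => by
    simp only [hY, hyrec]
    abel
  obtain ⟨hYb, hYs⟩ := hmix Y (fun n i => gf i (x i (n + 1)) - gf i (x i n)) hYrec
  obtain ⟨CY, hCY⟩ := hYb ⟨I * LF + I * LF, fun n => by
    simpa using Finset.sum_le_sum fun i (_ : i ∈ Finset.univ) =>
      (norm_sub_le (gf i (x i (n + 1))) (gf i (x i n))).trans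
        (add_le_add (hgb i _ (hxK _ i)) (hgb i _ (hxK _ i)))⟩
  have hCY0 : 0 ≤ CY := (disagreement_nonneg _).trans (hCY 0)
  have hyb : ∀ i n, ‖(I : ℝ) • y i n‖ ≤ I * CY + I * LF := fun i n => by
    have h1 : (I : ℝ) • y i n = (I : ℝ) • (Y n i - familyAverage (Y n))
        + ∑ i, gf i (x i n) := by
      rw [smul_sub, hYavg]
      abel
    rw [h1]
    refine (norm_add_le _ _).trans (add_le_add ?_ ?_)
    · rw [norm_smul, Real.norm_natCast]
      gcongr
      exact (norm_sub_familyAverage_le_disagreement _ _).trans (hCY n)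
    · simpa using norm_sum_le_of_le Finset.univ fun i _ => hgb i _ (hxK n i)
  -- best responses
  have hdesc : ∀ i n, τ i * ‖xt i n - x i n‖ ^ 2 + ⟪(I : ℝ) • y i n, xt i n - x i n⟫_ℝ
      + G (xt i n) ≤ G (x i n) := fun i n => by
    have h1 := hftgrad i _ (hxK n i) _ (hxK n i)
    rw [hF2 i _ (hxK n i)] at h1
    have := (hF1 i _ (hxK n i)).descent_of_isMin hG h1 (hxK n i) (hxtK i n) (hmin i n)
    rwa [hπt, add_sub_cancel] at this
  obtain ⟨Cd, hCd0, hCd⟩ : ∃ Cd : ℝ, 0 ≤ Cd ∧ ∀ i n, ‖xt i n - x i n‖ ≤ Cd := by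
    set Q := I * CY + I * LF + |LG|
    have hQ : 0 ≤ Q := by positivity
    have hpos : ∀ i, 0 ≤ Q / τ i := fun i => div_nonneg hQ (hτ i).le
    refine ⟨∑ i, Q / τ i, Finset.sum_nonneg fun i _ => hpos i, fun i n => ?_⟩
    refine le_trans ?_ (Finset.single_le_sum (f := fun i => Q / τ i) (fun i _ => hpos i)
      (Finset.mem_univ i))
    rw [le_div_iff₀' (hτ i)]
    rcases (norm_nonneg (xt i n - x i n)).eq_or_lt with h0 | h0
    · rw [← h0, mul_zero]; exact hQ
    have h1 := hdesc i n
    have h2 := (abs_le.1 (abs_real_inner_le_norm ((I : ℝ) • y i n) (xt i n - x i n))).1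
    have h3 := (abs_le.1 (hGL _ (hxtK i n) _ (hxK n i))).1
    have h4 := mul_le_mul_of_nonneg_right (hyb i n) h0.le
    refine le_of_mul_le_mul_right ?_ h0
    simp only [Q]
    nlinarith
  set Cz := Cb + Cd + 1 with hCz
  have hCz0 : 0 < Cz := by positivity
  have hzb : ∀ i n, ‖xinx i n - x i n‖ ≤ Cz := fun i n => by
    have h1 := norm_add_le (xinx i n - xt i n) (xt i n - x i n)
    rw [sub_add_sub_cancel] at h1
    linarith [(hinx i n).2, hCb i n, hCd i n]
  -- consensus of the iterates
  have hXrec : ∀ n i, X (n + 1) i = ∑ j, W n i j • X n j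
      + ∑ j, W n i j • (α n • (xinx j n - x j n)) := fun n i => by
    simp only [hX, hxrec, ← Finset.sum_add_distrib, ← smul_add]
  obtain ⟨-, hXs⟩ := hmix X (fun n i => ∑ j, W n i j • (α n • (xinx j n - x j n))) hXrec
  set Mx : ℕ → ℝ := fun n => disagreement (X n) with hMx
  set My : ℕ → ℝ := fun n => disagreement (Y n) with hMy
  have hMx0 : ∀ n, 0 ≤ Mx n := fun n => disagreement_nonneg _
  have hMy0 : ∀ n, 0 ≤ My n := fun n => disagreement_nonneg _
  have hMxs : Summable fun n => Mx n ^ 2 := by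
    refine hXs ((hαsq.mul_left ((I * Cz) ^ 2)).of_nonneg_of_le (fun n => sq_nonneg _) fun n => ?_)
    rw [← mul_pow]
    refine pow_le_pow_left₀ (Finset.sum_nonneg fun _ _ => norm_nonneg _) ?_ 2
    refine (sum_norm_sum_smul_le (hW0 n) (fun j => (hWcol n j).le) _).trans ?_
    rw [one_mul]
    have : ∀ j ∈ Finset.univ, ‖α n • (xinx j n - x j n)‖ ≤ Cz * α n := fun j _ => by
      rw [norm_smul, Real.norm_of_nonneg (hα0 n), mul_comm]
      exact mul_le_mul_of_nonneg_right (hzb j n) (hα0 n)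
    simpa [mul_assoc] using Finset.sum_le_sum this
  have hxdev : ∀ i n, ‖x i n - xbar n‖ ≤ Mx n := fun i n => by
    rw [← hXbar]
    exact norm_sub_familyAverage_le_disagreement (X n) i
  have hbarrec : ∀ n, xbar (n + 1) = familyAverage fun j => x j n + α n • (xinx j n - x j n) :=
    fun n => by
      have := familyAverage_mix (hWcol n) (fun j => x j n + α n • (xinx j n - x j n)) 0
      have hz : familyAverage (0 : Fin I → EuclideanSpace ℝ (Fin m)) = 0 := by
        simp [familyAverage]
      rw [hz, add_zero] at this
      rw [← hXbar, ← this]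
      congr 1
      ext1 i
      simp only [Pi.zero_apply, add_zero]
      exact hxrec i n
  have hbarrec' : ∀ n, xbar (n + 1) - xbar n
      = α n • familyAverage fun j => xinx j n - x j n := fun n => by
    rw [hbarrec, ← hXbar]
    simp only [havg, hX, Finset.sum_add_distrib, ← Finset.smul_sum, smul_add]
    rw [smul_comm]
    abel
  have hbarstep : ∀ n, ‖xbar (n + 1) - xbar n‖ ≤ Cz * α n := fun n => by
    rw [hbarrec', norm_smul, Real.norm_of_nonneg (hα0 n), mul_comm]
    exact mul_le_mul_of_nonneg_right (norm_familyAverage_le fun j => hzb j n) (hα0 n)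
  have hMys : Summable fun n => My n ^ 2 := by
    have h1 : Summable fun n => SL ^ 2 * (3 * (Mx (n + 1) ^ 2 + Mx n ^ 2 + Cz ^ 2 * α n ^ 2)) :=
      (((((summable_nat_add_iff (f := fun n => Mx n ^ 2) 1).2 hMxs).add hMxs).add
        (hαsq.mul_left _)).mul_left 3).mul_left _
    refine hYs (h1.of_nonneg_of_le (fun n => sq_nonneg _) fun n => ?_)
    have h2 : ∑ i, ‖gf i (x i (n + 1)) - gf i (x i n)‖
        ≤ SL * (Mx (n + 1) + Mx n + Cz * α n) := by
      rw [hSL, Finset.sum_mul]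
      refine Finset.sum_le_sum fun i _ => (hLip' i _ (hxK _ i) _ (hxK _ i)).trans ?_
      gcongr
      have h3 : x i (n + 1) - x i n = (x i (n + 1) - xbar (n + 1)) + (xbar (n + 1) - xbar n)
          + (xbar n - x i n) := by abel
      rw [h3]
      refine (norm_add₃_le).trans ?_
      rw [norm_sub_rev (xbar n)]
      linarith [hxdev i (n + 1), hxdev i n, hbarstep n]
    refine (pow_le_pow_left₀ (Finset.sum_nonneg fun _ _ => norm_nonneg _) h2 2).trans ?_
    rw [mul_pow]
    gcongr
    nlinarith [sq_nonneg (Mx (n + 1) - Mx n), sq_nonneg (Mx (n + 1) - Cz * α n),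
      sq_nonneg (Mx n - Cz * α n)]
  set Er : ℕ → ℝ := fun n => I * My n + SL * Mx n with hEr
  have hEr0 : ∀ n, 0 ≤ Er n := fun n =>
    add_nonneg (mul_nonneg hIpos.le (hMy0 n)) (mul_nonneg hSL0 (hMx0 n))
  have htrack : ∀ i n, ‖(I : ℝ) • y i n - gF (xbar n)‖ ≤ Er n := fun i n => by
    have h1 : (I : ℝ) • y i n - gF (xbar n) = (I : ℝ) • (Y n i - familyAverage (Y n))
        + ∑ j, (gf j (x j n) - gf j (xbar n)) := by
      rw [smul_sub, hYavg, Finset.sum_sub_distrib]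
      abel
    rw [h1]
    refine (norm_add_le _ _).trans (add_le_add ?_ ?_)
    · rw [norm_smul, Real.norm_natCast]
      gcongr
      exact norm_sub_familyAverage_le_disagreement _ _
    · rw [hSL, Finset.sum_mul]
      exact norm_sum_le_of_le _ fun j _ => (hLip' j _ (hxK n j) _ (hbarK n)).trans
        (by gcongr; exact hxdev j n)
  -- descent of the objective along the averages
  set U : EuclideanSpace ℝ (Fin m) → ℝ := fun z => (∑ i, f i z) + G z with hU
  have hGc : Continuous G := continuousOn_univ.mp (hG.continuousOn isOpen_univ)
  have hUc : ContinuousOn U K := (continuousOn_finsetSum _ fun i _ z hz =>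
    (hgfK i z hz).continuousAt.continuousWithinAt).add hGc.continuousOn
  obtain ⟨c, hc⟩ : ∃ c, ∀ z ∈ K, c ≤ U z := by
    obtain ⟨r, hr⟩ := hcoer 0
    obtain ⟨c, hc⟩ := ((isCompact_closedBall (0 : EuclideanSpace ℝ (Fin m)) r).inter_left
      hKcl).bddBelow_image (hUc.mono Set.inter_subset_left)
    refine ⟨min c 0, fun z hz => ?_⟩
    rcases le_total r ‖z‖ with h | h
    · exact (min_le_right _ _).trans (hr z hz h)
    · exact (min_le_left _ _).trans (hc ⟨z, ⟨hz, by simpa using h⟩, rfl⟩)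
  set p : ℕ → ℝ := fun n => α n * ((I : ℝ)⁻¹ * ∑ j, τ j * ‖xt j n - x j n‖ ^ 2) with hp
  set A : ℝ := I * LF + |LG|
  have hA0 : 0 ≤ A := by positivity
  set s : ℕ → ℝ := fun n => SL * Cz ^ 2 * α n ^ 2
    + α n * ((I : ℝ)⁻¹ * ∑ j, (A * ε j n + Er n * Cd + |LG| * Mx n)) with hs
  have hp0 : ∀ n, 0 ≤ p n := fun n => mul_nonneg (hα0 n) (mul_nonneg (by positivity)
    (Finset.sum_nonneg fun j _ => mul_nonneg (hτ j).le (sq_nonneg _)))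
  have hs0 : ∀ n, 0 ≤ s n := fun n => add_nonneg (by positivity) (mul_nonneg (hα0 n)
    (mul_nonneg (by positivity) (Finset.sum_nonneg fun j _ => add_nonneg (add_nonneg
      (mul_nonneg hA0 (hεnn j n)) (mul_nonneg (hEr0 n) hCd0))
        (mul_nonneg (abs_nonneg _) (hMx0 n)))))
  have hαMx : Summable fun n => α n * Mx n := summable_mul_of_summable_sq hα0 hMx0 hαsq hMxs
  have hαMy : Summable fun n => α n * My n := summable_mul_of_summable_sq hα0 hMy0 hαsq hMys
  have hss : Summable s := by
    refine (hαsq.mul_left _).add ?_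
    have h1 : Summable fun n => (I : ℝ)⁻¹ * ∑ j, (A * (α n * ε j n)
        + Cd * (I * (α n * My n) + SL * (α n * Mx n)) + |LG| * (α n * Mx n)) :=
      (summable_sum fun j _ => (((hεsum j).mul_left A).add
        (((hαMy.mul_left _).add (hαMx.mul_left _)).mul_left Cd)).add
          (hαMx.mul_left _)).mul_left _
    refine h1.congr fun n => ?_
    rw [mul_left_comm (α n), Finset.mul_sum (a := α n)]
    congr 1
    refine Finset.sum_congr rfl fun j _ => ?_
    simp only [hEr]
    ring
  have hUrec : ∀ n, U (xbar (n + 1)) + p n ≤ U (xbar n) + s n := fun n => by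
    have hFstep : ∑ i, f i (xbar (n + 1)) ≤ ∑ i, f i (xbar n)
        + ⟪gF (xbar n), xbar (n + 1) - xbar n⟫_ℝ + SL * (Cz * α n) ^ 2 := by
      rw [hgF, hSL, sum_inner, Finset.sum_mul, ← Finset.sum_add_distrib, ← Finset.sum_add_distrib]
      refine Finset.sum_le_sum fun i _ => ?_
      have h1 := le_of_abs_le (abs_sub_sub_inner_le_of_lipschitz_gradient hKcv (hgfK i) (hLip i)
        (hbarK n) (hbarK (n + 1)))
      have h2 : |L i| * ‖xbar (n + 1) - xbar n‖ ^ 2 ≤ |L i| * (Cz * α n) ^ 2 := by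
        gcongr
        exact hbarstep n
      linarith
    have hinner : ⟪gF (xbar n), xbar (n + 1) - xbar n⟫_ℝ
        = α n * ((I : ℝ)⁻¹ * ∑ j, ⟪gF (xbar n), xinx j n - x j n⟫_ℝ) := by
      rw [hbarrec', havg, inner_smul_right, inner_smul_right, inner_sum]
    have hGstep : G (xbar (n + 1)) ≤ G (xbar n)
        + α n * ((I : ℝ)⁻¹ * ∑ j, (G (xinx j n) - G (xbar n))) := by
      have h1 : xbar (n + 1) = (1 - α n) • xbar n
          + α n • ∑ j, (I : ℝ)⁻¹ • xinx j n := by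
        rw [eq_add_of_sub_eq (hbarrec' n), havg, Finset.sum_sub_distrib, smul_sub, ← hxbar,
          Finset.smul_sum]
        module
      have h2 := hG.2 (Set.mem_univ (xbar n)) (Set.mem_univ (∑ j, (I : ℝ)⁻¹ • xinx j n))
        (sub_nonneg.2 (hα n).2) (hα0 n) (sub_add_cancel 1 _)
      have h3 := hG.map_sum_le (t := Finset.univ) (w := fun _ : Fin I => (I : ℝ)⁻¹)
        (p := fun j => xinx j n) (fun _ _ => by positivity) (by simp [hIpos.ne'])
        fun _ _ => Set.mem_univ _
      rw [← h1] at h2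
      simp only [smul_eq_mul, ← Finset.mul_sum] at h2 h3
      have h4 : (I : ℝ)⁻¹ * ∑ j, (G (xinx j n) - G (xbar n))
          = (I : ℝ)⁻¹ * ∑ j, G (xinx j n) - G (xbar n) := by
        rw [Finset.sum_sub_distrib, mul_sub]
        simp [hIpos.ne']
      rw [h4]
      nlinarith [mul_le_mul_of_nonneg_left h3 (hα0 n)]
    have hj : ∀ j, ⟪gF (xbar n), xinx j n - x j n⟫_ℝ + (G (xinx j n) - G (xbar n))
        + τ j * ‖xt j n - x j n‖ ^ 2 ≤ A * ε j n + Er n * Cd + |LG| * Mx n := fun j => by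
      have e0 : ⟪gF (xbar n), xinx j n - x j n⟫_ℝ = ⟪gF (xbar n), xinx j n - xt j n⟫_ℝ
          + ⟪gF (xbar n) - (I : ℝ) • y j n, xt j n - x j n⟫_ℝ
          + ⟪(I : ℝ) • y j n, xt j n - x j n⟫_ℝ := by
        rw [add_assoc, ← inner_add_left, sub_add_cancel, ← inner_add_right, sub_add_sub_cancel]
      have e1 : ⟪gF (xbar n), xinx j n - xt j n⟫_ℝ ≤ I * LF * ε j n :=
        (real_inner_le_norm _ _).trans (mul_le_mul (hgFb _ (hbarK n)) (hinx j n).2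
          (norm_nonneg _) (by positivity))
      have e2 : ⟪gF (xbar n) - (I : ℝ) • y j n, xt j n - x j n⟫_ℝ ≤ Er n * Cd :=
        (real_inner_le_norm _ _).trans (mul_le_mul (by rw [norm_sub_rev]; exact htrack j n)
          (hCd j n) (norm_nonneg _) (hEr0 n))
      have e3 := hdesc j n
      have e4 : G (xinx j n) - G (xt j n) ≤ |LG| * ε j n :=
        (le_of_abs_le (hGL _ (hinx j n).1 _ (hxtK j n))).trans
          (by gcongr; exact (hinx j n).2)
      have e5 : G (x j n) - G (xbar n) ≤ |LG| * Mx n :=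
        (le_of_abs_le (hGL _ (hxK n j) _ (hbarK n))).trans (by gcongr; exact hxdev j n)
      simp only [A]
      linarith
    have hsum := Finset.sum_le_sum fun j (_ : j ∈ Finset.univ) => hj j
    rw [Finset.sum_add_distrib, Finset.sum_add_distrib] at hsum
    have hsum' := mul_le_mul_of_nonneg_left (mul_le_mul_of_nonneg_left hsum
      (inv_nonneg.2 hIpos.le)) (hα0 n)
    rw [hinner] at hFstep
    simp only [hU, hp, hs]
    simp only [mul_add] at hsum'
    rw [mul_pow] at hFstep
    linarith
  obtain ⟨hps, C, hC⟩ := summable_and_bounded_of_add_le_add (fun n => hc _ (hbarK n)) hp0 hs0 hss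
    hUrec
  -- vanishing of the best-response displacements
  have hMxt : Tendsto Mx atTop (nhds 0) := tendsto_zero_of_summable_sq hMxs
  have hMyt : Tendsto My atTop (nhds 0) := tendsto_zero_of_summable_sq hMys
  have hErt : Tendsto Er atTop (nhds 0) := by
    simpa using (hMyt.const_mul (I : ℝ)).add (hMxt.const_mul SL)
  have hbardist : ∀ n k, ‖xbar n - xbar (n + k)‖
      ≤ Cz * ∑ l ∈ Finset.range k, α (n + l) := fun n k => by
    induction k with
    | zero => simp
    | succ k ih =>
      rw [Finset.sum_range_succ, mul_add]
      have h1 := norm_sub_le_norm_sub_add_norm_sub (xbar n) (xbar (n + k)) (xbar (n + (k + 1)))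
      rw [norm_sub_rev (xbar (n + k))] at h1
      have h2 := hbarstep (n + k)
      rw [add_assoc] at h2
      linarith
  have hdt : ∀ i, Tendsto (fun n => ‖xt i n - x i n‖) atTop (nhds 0) := fun i => by
    have hτi := hτ i
    set R : ℝ := 1 + (|Lt| + SL) / τ i with hR
    have hR0 : 0 < R := by positivity
    refine tendsto_zero_of_summable_mul_sq (C := (R + SL / τ i) * Cz)
      (e := fun n => R * Mx n + Er n / τ i) (by positivity) hα0 hαdiv
      (fun n => norm_nonneg _) ?_ (by simpa using (hMxt.const_mul R).add (hErt.div_const (τ i)))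
      fun n k => ?_
    · refine (hps.mul_left (I / τ i)).of_nonneg_of_le
        (fun n => mul_nonneg (hα0 n) (sq_nonneg _)) fun n => ?_
      have h1 := Finset.single_le_sum (f := fun j => τ j * ‖xt j n - x j n‖ ^ 2)
        (fun j _ => mul_nonneg (hτ j).le (sq_nonneg _)) (Finset.mem_univ i)
      have h2 : I / τ i * p n = α n * ((∑ j, τ j * ‖xt j n - x j n‖ ^ 2) / τ i) := by
        simp only [hp]
        field_simp
      rw [h2]
      refine mul_le_mul_of_nonneg_left ?_ (hα0 n)
      rw [le_div_iff₀' hτi]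
      exact h1
    · set b := ‖xbar n - xbar (n + k)‖
      have hxx : ‖x i n - x i (n + k)‖ ≤ Mx n + Mx (n + k) + b := by
        have h3 : x i n - x i (n + k) = (x i n - xbar n) + (xbar n - xbar (n + k))
          + (xbar (n + k) - x i (n + k)) := by abel
        rw [h3]
        refine (norm_add₃_le).trans ?_
        rw [norm_sub_rev (xbar (n + k)) (x i (n + k))]
        linarith [hxdev i n, hxdev i (n + k)]
      have hππ : ‖πt i n - πt i (n + k)‖
          ≤ Er n + Er (n + k) + SL * b + SL * ‖x i n - x i (n + k)‖ := by
        have h3 : πt i n - πt i (n + k) = ((I : ℝ) • y i n - gF (xbar n))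
            - ((I : ℝ) • y i (n + k) - gF (xbar (n + k))) + (gF (xbar n) - gF (xbar (n + k)))
            - (gf i (x i n) - gf i (x i (n + k))) := by
          rw [hπt, hπt]
          abel
        rw [h3]
        have h4 := norm_sub_le ((I : ℝ) • y i n - gF (xbar n))
          ((I : ℝ) • y i (n + k) - gF (xbar (n + k)))
        have h5 := hgFL _ (hbarK n) _ (hbarK (n + k))
        have h6 := (hLip' i _ (hxK n i) _ (hxK (n + k) i)).trans
          (mul_le_mul_of_nonneg_right (hLSL i) (norm_nonneg _))
        refine (norm_sub_le _ _).trans (add_le_add ((norm_add_le _ _).trans ?_) h6)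
        linarith [htrack i n, htrack i (n + k)]
      have hzz := StrongConvexOn.mul_norm_sub_le_of_isMin (C := |Lt| * ‖x i n - x i (n + k)‖)
        hKcv (hF1 i _ (hxK n i)) (hF1 i _ (hxK (n + k) i)) hG (hftgrad i _ (hxK n i))
        (hftgrad i _ (hxK (n + k) i))
        (fun z hz => (hF3 i z hz _ (hxK n i) _ (hxK (n + k) i)).trans
          (mul_le_mul_of_nonneg_right (le_abs_self _) (norm_nonneg _)))
        (hxtK i n) (hxtK i (n + k)) (hmin i n) (hmin i (n + k))
      have htri : ‖xt i n - x i n‖ ≤ ‖xt i (n + k) - x i (n + k)‖ + ‖xt i n - xt i (n + k)‖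
          + ‖x i n - x i (n + k)‖ := by
        have h3 : xt i n - x i n = (xt i (n + k) - x i (n + k)) + (xt i n - xt i (n + k))
          - (x i n - x i (n + k)) := by abel
        rw [h3]
        exact (norm_sub_le _ _).trans (add_le_add (norm_add_le _ _) le_rfl)
      have hzz' : ‖xt i n - xt i (n + k)‖ ≤ ((|Lt| + SL) * ‖x i n - x i (n + k)‖
          + Er n + Er (n + k) + SL * b) / τ i := by
        rw [le_div_iff₀' hτi]
        linarith
      have hfin : ‖xt i n - x i n‖ ≤ ‖xt i (n + k) - x i (n + k)‖
          + R * (Mx n + Mx (n + k) + b) + (Er n + Er (n + k) + SL * b) / τ i := by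
        have h3 : R * ‖x i n - x i (n + k)‖ = ‖x i n - x i (n + k)‖
            + (|Lt| + SL) * ‖x i n - x i (n + k)‖ / τ i := by
          rw [hR]
          ring
        have h4 := mul_le_mul_of_nonneg_left hxx hR0.le
        rw [add_assoc _ (Er n), add_assoc _ (Er n + Er (n + k)), add_div] at hzz'
        linarith
      refine hfin.trans ?_
      have h5 : (R + SL / τ i) * b ≤ (R + SL / τ i) * (Cz * ∑ l ∈ Finset.range k, α (n + l)) :=
        mul_le_mul_of_nonneg_left (hbardist n k) (by positivity)
      rw [← mul_assoc] at h5
      have h6 : (Er n + Er (n + k) + SL * b) / τ i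
          = Er n / τ i + Er (n + k) / τ i + SL / τ i * b := by ring
      rw [h6]
      linarith
  refine ⟨⟨?_, fun q hq => ?_⟩, fun i => squeeze_zero (fun n => norm_nonneg _) (hxdev i) hMxt⟩
  · obtain ⟨r, hr⟩ := hcoer (C + 1)
    refine ⟨r, fun n => ?_⟩
    by_contra! h
    have h1 : C + 1 ≤ U (xbar n) := hr _ (hbarK n) h.le
    linarith [hC n]
  · obtain ⟨ψ, hψ, hψt⟩ := hq.tendsto_subseq
    have hqK : q ∈ K := hKcl.mem_of_tendsto hψt (Eventually.of_forall fun n => hbarK _)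
    refine ⟨hqK, hG.exists_subgradient_of_forall_le hKcv hqK _ ?_⟩
    set i : Fin I := ⟨0, hI⟩
    have hψ' := hψ.tendsto_atTop
    have hxq : Tendsto (fun n => x i (ψ n)) atTop (nhds q) := by
      have h1 : Tendsto (fun n => x i (ψ n) - xbar (ψ n)) atTop (nhds 0) :=
        squeeze_zero_norm (fun n => hxdev i _) (hMxt.comp hψ')
      simpa using h1.add hψt
    have hxtq : Tendsto (fun n => xt i (ψ n)) atTop (nhds q) := by
      have h1 : Tendsto (fun n => xt i (ψ n) - x i (ψ n)) atTop (nhds 0) :=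
        tendsto_zero_iff_norm_tendsto_zero.2 ((hdt i).comp hψ')
      simpa using h1.add hxq
    have hyq : Tendsto (fun n => (I : ℝ) • y i (ψ n)) atTop (nhds (gF q)) := by
      have h1 : Tendsto (fun n => (I : ℝ) • y i (ψ n) - gF (xbar (ψ n))) atTop (nhds 0) :=
        squeeze_zero_norm (fun n => htrack i _) (hErt.comp hψ')
      have h2 : Tendsto (fun n => gF (xbar (ψ n)) - gF q) atTop (nhds 0) := by
        refine squeeze_zero_norm (fun n => hgFL _ (hbarK _) q hqK) ?_
        simpa using (tendsto_iff_norm_sub_tendsto_zero.1 hψt).const_mul SL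
      simpa using (h1.add h2).add_const (gF q)
    have hgq : Tendsto (fun n => gf i (x i (ψ n))) atTop (nhds (gf i q)) :=
      (((hgradcont i).continuousAt (hUo.mem_nhds (hKUo hqK))).tendsto).comp hxq
    have hπq : Tendsto (fun n => πt i (ψ n)) atTop (nhds (gF q - gf i q)) := by
      simp only [hπt]
      exact hyq.sub hgq
    have hgrad := hftgrad i q hqK q hqK
    rw [hF2 i q hqK] at hgrad
    have hlim : ∀ u ∈ K, ft i q q - ft i u q ≤ ⟪gF q - gf i q, u - q⟫_ℝ + G u - G q := by
      intro u hu
      have hle : ∀ n, ft i (xt i (ψ n)) q - ft i u q ≤ ⟪πt i (ψ n), u - xt i (ψ n)⟫_ℝ + G u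
          - G (xt i (ψ n)) + |Lt| * ‖x i (ψ n) - q‖ * ‖u - xt i (ψ n)‖ := fun n => by
        have h1 := hmin i (ψ n) u hu
        have h2 := (abs_le.1 (abs_sub_sub_sub_le_of_gradient_sub_le hKcv
          (hftgrad i _ (hxK (ψ n) i)) (hftgrad i q hqK)
          (fun z hz => (hF3 i z hz _ (hxK (ψ n) i) q hqK).trans
            (mul_le_mul_of_nonneg_right (le_abs_self _) (norm_nonneg _)))
          (hxtK i (ψ n)) hu)).2
        have h3 : ⟪πt i (ψ n), u - xt i (ψ n)⟫_ℝ = ⟪πt i (ψ n), u - x i (ψ n)⟫_ℝ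
            - ⟪πt i (ψ n), xt i (ψ n) - x i (ψ n)⟫_ℝ := by
          rw [← inner_sub_right, sub_sub_sub_cancel_right]
        linarith
      have hut : Tendsto (fun n => u - xt i (ψ n)) atTop (nhds (u - q)) := hxtq.const_sub u
      have hL : Tendsto (fun n => ft i (xt i (ψ n)) q - ft i u q) atTop
          (nhds (ft i q q - ft i u q)) :=
        (hgrad.continuousAt.tendsto.comp hxtq).sub_const _
      have hR := (((hπq.inner hut).add_const (G u)).sub ((hGc.tendsto q).comp hxtq)).add
        (((tendsto_iff_norm_sub_tendsto_zero.1 hxq).const_mul |Lt|).mul hut.norm)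
      rw [mul_zero, zero_mul, add_zero] at hR
      exact le_of_tendsto_of_tendsto' hL hR hle
    have hfinal := hG.le_inner_add_of_forall_le hKcv hqK hgrad hlim
    simpa only [add_sub_cancel] using hfinal
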